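/- Let a_M ∈ L¹(Ω̃), φ ∈ C(Ω̄×Ȳ) Y-periodic in y, and a(x,y) the two-scale continuous extension of a_M. Then ∫_Ω a(x,x/ε)φ(x,x/ε) dx → ∫_Ω ∫_Y a(x,y)φ(x,y) dy dx as ε→0 (assuming ∂Ω is regular enough that boundary cube layers have vanishing measure contribution). -/

import Mathlib

open MeasureTheory Filter Topology Function Matrix

noncomputable section

/-- The unit cube `Y = (0,1)^d`. -/
def unitCube (d : ℕ) : Set (Fin d → ℝ) := Set.univ.pi fun _ => Set.Ioo (0:ℝ) 1

/-- The axis-aligned closed cube of side `r` centered at `c`. -/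
def cube {d : ℕ} (c : Fin d → ℝ) (r : ℝ) : Set (Fin d → ℝ) := {z | ∀ k, |z k - c k| ≤ r / 2}

/-- `f(x, ·)` is `Y`-periodic (period `1` in each coordinate direction). -/
def YPeriodic {d : ℕ} (f : (Fin d → ℝ) → (Fin d → ℝ) → ℝ) : Prop :=
  ∀ (x y : Fin d → ℝ) (m : Fin d → ℤ), f x (y + fun i => (m i : ℝ)) = f x y

/-- Test functions `ψ ∈ D(Ω × Y)`: `Y`-periodic in `y`, and on `Ω × Y` given by a smooth
compactly supported function with support inside `Ω × Y`. -/
def IsTestFunction {d : ℕ} (Ω : Set (Fin d → ℝ)) (ψ : (Fin d → ℝ) → (Fin d → ℝ) → ℝ) : Prop :=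
  YPeriodic ψ ∧ ∃ ψ₀ : (Fin d → ℝ) × (Fin d → ℝ) → ℝ,
    ContDiff ℝ (⊤ : ℕ∞) ψ₀ ∧ HasCompactSupport ψ₀ ∧
    tsupport ψ₀ ⊆ Ω ×ˢ unitCube d ∧
    ∀ x y, y ∈ unitCube d → ψ x y = ψ₀ (x, y)

/-- Two-scale convergence of `u_ε` (indexed along a sequence `ε n → 0`) to `u₀ ∈ L²(Ω×Y)`:
boundedness in `L²(Ω)` together with convergence against every test function in `D(Ω×Y)`. -/
def TwoScale {d : ℕ} (Ω : Set (Fin d → ℝ)) (ε : ℕ → ℝ)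
    (u : ℕ → (Fin d → ℝ) → ℝ) (u₀ : (Fin d → ℝ) → (Fin d → ℝ) → ℝ) : Prop :=
  (∃ C : ℝ, ∀ n, ∫ x in Ω, (u n x) ^ 2 ≤ C) ∧
  ∀ ψ, IsTestFunction Ω ψ →
    Tendsto (fun n => ∫ x in Ω, u n x * ψ x ((ε n)⁻¹ • x)) atTop
      (𝓝 (∫ x in Ω, ∫ y in unitCube d, u₀ x y * ψ x y))

/-- `φ` is an admissible test function: one may pass to the two-scale limit against it. -/
def Admissible {d : ℕ} (Ω : Set (Fin d → ℝ)) (ε : ℕ → ℝ)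
    (φ : (Fin d → ℝ) → (Fin d → ℝ) → ℝ) : Prop :=
  ∀ u u₀, TwoScale Ω ε u u₀ →
    Tendsto (fun n => ∫ x in Ω, u n x * φ x ((ε n)⁻¹ • x)) atTop
      (𝓝 (∫ x in Ω, ∫ y in unitCube d, u₀ x y * φ x y))

/-- The two-scale Continuous Extension of `a_M` with parameter `ε̄ = eb`:
`a(x,y) = ã(x, ε̄ y)` where `ã(x,·) = a_M` on the `ε̄`-cube `W(x)` centered at `x`,
extended `ε̄`-periodically. -/
def contExt {d : ℕ} (aM : (Fin d → ℝ) → ℝ) (eb : ℝ) (x y : Fin d → ℝ) : ℝ :=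
  aM fun k => x k + eb * (Int.fract (y k - x k / eb + 1/2) - 1/2)

/-- The two-scale Discrete Extension of `a_M` associated to a partition `Ω = ⋃ j, Ωp j`
with `ε̄`-cubes `W_j` centered at `xh j`. -/
def discExt {d : ℕ} (aM : (Fin d → ℝ) → ℝ) (eb : ℝ) {N : ℕ} (Ωp : Fin N → Set (Fin d → ℝ))
    (xh : Fin N → (Fin d → ℝ)) (x y : Fin d → ℝ) : ℝ :=
  ∑ j, (Ωp j).indicator (fun _ => contExt aM eb (xh j) y) x

/-- `ε̄`-periodicity of a function on `ℝ^d`. -/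
def perZ {d : ℕ} (eb : ℝ) (f : (Fin d → ℝ) → ℝ) : Prop :=
  ∀ (z : Fin d → ℝ) (m : Fin d → ℤ), f (z + eb • fun i => (m i : ℝ)) = f z

/-- `g` is the weak gradient of `f`. -/
def IsWeakGrad {d : ℕ} (f : (Fin d → ℝ) → ℝ) (g : (Fin d → ℝ) → (Fin d → ℝ)) : Prop :=
  LocallyIntegrable f volume ∧ (∀ k, LocallyIntegrable (fun z => g z k) volume) ∧
  ∀ ψ : (Fin d → ℝ) → ℝ, ContDiff ℝ (⊤ : ℕ∞) ψ → HasCompactSupport ψ → ∀ k : Fin d,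
    ∫ z, f z * fderiv ℝ ψ z (Pi.single k 1) = - ∫ z, g z k * ψ z


/-- The componentwise fractional part. -/
def fractVec {d : ℕ} (y : Fin d → ℝ) : Fin d → ℝ := fun k => Int.fract (y k)

/-- The point of the `eb`-cube centered at `x` at which `contExt aM eb x y` evaluates `aM`. -/
def cubePoint {d : ℕ} (eb : ℝ) (x y : Fin d → ℝ) : Fin d → ℝ :=
  fun k => x k + eb * (Int.fract (y k - x k / eb + 1/2) - 1/2)

lemma measurable_fractVec {d : ℕ} : Measurable (fractVec (d := d)) :=
  measurable_pi_lambda _ fun k => (measurable_pi_apply k).fract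

lemma measurable_cubePoint {d : ℕ} (eb : ℝ) :
    Measurable fun p : (Fin d → ℝ) × (Fin d → ℝ) => cubePoint eb p.1 p.2 := by
  refine measurable_pi_lambda _ fun k => ?_
  have h1 : Measurable fun p : (Fin d → ℝ) × (Fin d → ℝ) => p.1 k :=
    (measurable_pi_apply k).comp measurable_fst
  have h2 : Measurable fun p : (Fin d → ℝ) × (Fin d → ℝ) => p.2 k :=
    (measurable_pi_apply k).comp measurable_snd
  exact h1.add ((((h2.sub (h1.div_const eb)).add_const _).fract.sub_const _).const_mul eb)

lemma norm_fractVec_le {d : ℕ} (y : Fin d → ℝ) : ‖fractVec y‖ ≤ 1 :=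
  (pi_norm_le_iff_of_nonneg zero_le_one).2 fun k => by
    rw [Real.norm_eq_abs, fractVec, abs_of_nonneg (Int.fract_nonneg _)]
    exact (Int.fract_lt_one _).le

lemma measurePreserving_fract_add (c : ℝ) :
    MeasurePreserving (fun y : ℝ => Int.fract (y + c))
      (volume.restrict (Set.Ioo 0 1)) (volume.restrict (Set.Ioo 0 1)) := by
  have hm : Measurable fun y : ℝ => Int.fract (y + c) := (measurable_id.add_const c).fract
  refine ⟨hm, Measure.ext fun B hB => ?_⟩
  rw [Measure.map_apply hm hB, restrict_Ioo_eq_restrict_Ioc, Measure.restrict_apply (hm hB),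
    ← restrict_Ioo_eq_restrict_Ioc, restrict_Ioo_eq_restrict_Ico, Measure.restrict_apply hB]
  set A : Set ℝ := Int.fract ⁻¹' B with hA
  have hAm : MeasurableSet A := measurable_fract hB
  have hshift : (fun y : ℝ => Int.fract (y + c)) ⁻¹' B ∩ Set.Ioc 0 1
      = (fun y => y + c) ⁻¹' (A ∩ Set.Ioc c (c + 1)) := by
    ext y
    simp only [hA, Set.mem_inter_iff, Set.mem_preimage, Set.mem_Ioc]
    constructor <;> rintro ⟨h, h', h''⟩ <;> exact ⟨h, by linarith, by linarith⟩
  have hinv := (isAddFundamentalDomain_Ioc (T := (1:ℝ)) one_pos c).measure_set_eq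
    (isAddFundamentalDomain_Ioc (T := (1:ℝ)) one_pos 0) (A := A) hAm (by
      rintro ⟨g, hg⟩
      obtain ⟨n, rfl⟩ := AddSubgroup.mem_zmultiples_iff.1 hg
      ext y
      simp [hA, AddSubgroup.vadd_def, Int.fract_intCast_add])
  rw [hshift, measure_preimage_add_right, hinv, zero_add]
  have h1 : volume (A ∩ Set.Ioc 0 1) = volume (A ∩ Set.Ico 0 1) :=
    measure_congr ((ae_eq_refl A).inter Ico_ae_eq_Ioc.symm)
  rw [h1]
  congr 1
  ext y
  simp only [hA, Set.mem_inter_iff, Set.mem_preimage, Set.mem_Ico]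
  refine and_congr_left fun h => ?_
  rw [Int.fract_eq_self.2 h]

lemma restrict_unitCube (d : ℕ) :
    (volume.restrict (unitCube d) : Measure (Fin d → ℝ))
      = Measure.pi fun _ => volume.restrict (Set.Ioo (0:ℝ) 1) := by
  rw [unitCube, volume_pi, Measure.restrict_pi_pi]

lemma volume_unitCube (d : ℕ) : volume (unitCube d) = 1 := by
  simp [unitCube, volume_pi, Measure.pi_pi]

instance instIsProbabilityMeasureUnitCube (d : ℕ) :
    IsProbabilityMeasure (volume.restrict (unitCube d)) :=
  ⟨by rw [Measure.restrict_apply_univ, volume_unitCube]⟩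

lemma measurePreserving_fractVec_add {d : ℕ} (c : Fin d → ℝ) :
    MeasurePreserving (fun y => fractVec (y + c))
      (volume.restrict (unitCube d)) (volume.restrict (unitCube d)) := by
  rw [restrict_unitCube]
  exact measurePreserving_pi _ _ fun k => measurePreserving_fract_add (c k)

lemma YPeriodic.apply_fractVec {d : ℕ} {G : (Fin d → ℝ) → (Fin d → ℝ) → ℝ} (hG : YPeriodic G)
    (x y : Fin d → ℝ) : G x (fractVec y) = G x y := by
  rw [← hG x (fractVec y) fun k => ⌊y k⌋]
  congr 1
  ext k
  exact Int.fract_add_floor (y k)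

lemma YPeriodic.apply_add_fractVec {d : ℕ} {G : (Fin d → ℝ) → (Fin d → ℝ) → ℝ}
    (hG : YPeriodic G) (x y z : Fin d → ℝ) : G x (z + fractVec (y - z)) = G x y := by
  rw [← hG x (z + fractVec (y - z)) fun k => ⌊y k - z k⌋]
  congr 1
  ext k
  have := Int.fract_add_floor (y k - z k)
  simp only [Pi.add_apply, fractVec, Pi.sub_apply]
  linarith

/-- Rescaled integrals of a bounded periodic function as shifted two-scale averages. -/
lemma integral_rescaled_eq_integral_shifted {d : ℕ} {G : (Fin d → ℝ) → (Fin d → ℝ) → ℝ}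
    (hG : YPeriodic G) (hm : Measurable (uncurry G)) {M R : ℝ} (hM : ∀ x y, |G x y| ≤ M)
    (hR : ∀ x y, R < ‖x‖ → G x y = 0) {ε : ℝ} (hε : 0 < ε) (hε1 : ε ≤ 1) :
    ∫ x, G x (ε⁻¹ • x)
      = ∫ x, ∫ y in unitCube d, G (x + ε • fractVec (y - ε⁻¹ • x)) y := by
  set h : (Fin d → ℝ) → ℝ := fun x => G x (ε⁻¹ • x) with hh
  have hhm : Measurable h := hm.comp (measurable_id.prodMk (measurable_id.const_smul ε⁻¹))
  have hint : Integrable (uncurry fun (s x : Fin d → ℝ) => h (x + ε • fractVec s))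
      ((volume.restrict (unitCube d)).prod volume) := by
    have hmeas : Measurable (uncurry fun (s x : Fin d → ℝ) => h (x + ε • fractVec s)) :=
      hhm.comp (measurable_snd.add ((measurable_fractVec.comp measurable_fst).const_smul ε))
    have hbound : Integrable (fun p : (Fin d → ℝ) × (Fin d → ℝ) =>
        (Metric.closedBall (0 : Fin d → ℝ) (R + 1)).indicator (fun _ => M) p.2)
        ((volume.restrict (unitCube d)).prod volume) := by
      refine Integrable.comp_snd ?_ _
      exact (integrable_indicator_iff measurableSet_closedBall).2
        (integrableOn_const measure_closedBall_lt_top.ne)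
    refine hbound.mono' hmeas.aestronglyMeasurable (ae_of_all _ fun p => ?_)
    by_cases hp : p.2 ∈ Metric.closedBall (0 : Fin d → ℝ) (R + 1)
    · rw [Set.indicator_of_mem hp]
      exact hM _ _
    · rw [Set.indicator_of_notMem hp]
      have hz : h (p.2 + ε • fractVec p.1) = 0 := by
        refine hR _ _ ?_
        have h1 : ‖ε • fractVec p.1‖ ≤ 1 := by
          rw [norm_smul, Real.norm_eq_abs, abs_of_pos hε]
          exact mul_le_one₀ hε1 (norm_nonneg _) (norm_fractVec_le _)
        have h2 : R + 1 < ‖p.2‖ := by simpa using hp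
        have h3 := norm_sub_le (p.2 + ε • fractVec p.1) (ε • fractVec p.1)
        rw [add_sub_cancel_right] at h3
        linarith
      simp [uncurry, hz]
  calc ∫ x, h x = ∫ _s in unitCube d, ∫ x, h x := by simp
    _ = ∫ s in unitCube d, ∫ x, h (x + ε • fractVec s) := by
        simp only [integral_add_right_eq_self]
    _ = ∫ x, ∫ s in unitCube d, h (x + ε • fractVec s) := integral_integral_swap hint
    _ = ∫ x, ∫ y in unitCube d, G (x + ε • fractVec (y - ε⁻¹ • x)) y := by
        refine integral_congr_ae (ae_of_all _ fun x => ?_)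
        have hmp := measurePreserving_fractVec_add (-(ε⁻¹ • x))
        have hsm : StronglyMeasurable fun s => h (x + ε • fractVec s) :=
          (hhm.comp ((measurable_fractVec.const_smul ε).const_add x)).stronglyMeasurable
        have key := integral_map (μ := volume.restrict (unitCube d)) hmp.measurable.aemeasurable
          (f := fun s => h (x + ε • fractVec s)) hsm.aestronglyMeasurable
        rw [hmp.map_eq] at key
        refine key.trans (integral_congr_ae (ae_of_all _ fun y => ?_))
        have hff : fractVec (fractVec (y + -(ε⁻¹ • x))) = fractVec (y - ε⁻¹ • x) := by
          ext k
          simp [fractVec, sub_eq_add_neg]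
        simp only [hh, hff]
        rw [smul_add, smul_smul, inv_mul_cancel₀ hε.ne', one_smul, hG.apply_add_fractVec]

/-- Mean-value property for bounded periodic integrands that are a.e. continuous in the slow
variable. -/
lemma tendsto_integral_rescaled {d : ℕ} {G : (Fin d → ℝ) → (Fin d → ℝ) → ℝ}
    (hG : YPeriodic G) (hm : Measurable (uncurry G)) {M R : ℝ} (hM : ∀ x y, |G x y| ≤ M)
    (hR : ∀ x y, R < ‖x‖ → G x y = 0)
    (hc : ∀ᵐ x, ∀ᵐ y ∂volume.restrict (unitCube d), ContinuousAt (fun x' => G x' y) x) :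
    Tendsto (fun ε : ℝ => ∫ x, G x (ε⁻¹ • x)) (𝓝[>] (0:ℝ))
      (𝓝 (∫ x, ∫ y in unitCube d, G x y)) := by
  have hsmall : ∀ᶠ ε : ℝ in 𝓝[>] (0:ℝ), 0 < ε ∧ ε ≤ 1 := by
    filter_upwards [Ioc_mem_nhdsGT (zero_lt_one' ℝ)] with ε hε using hε
  have hmε : ∀ ε : ℝ, Measurable fun p : (Fin d → ℝ) × (Fin d → ℝ) =>
      G (p.1 + ε • fractVec (p.2 - ε⁻¹ • p.1)) p.2 := fun ε =>
    hm.comp ((measurable_fst.add ((measurable_fractVec.comp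
      (measurable_snd.sub (measurable_fst.const_smul ε⁻¹))).const_smul ε)).prodMk measurable_snd)
  have hdist : ∀ {ε : ℝ}, 0 < ε → ∀ z : Fin d → ℝ, ‖ε • fractVec z‖ ≤ ε := fun {ε} hε z => by
    rw [norm_smul, Real.norm_eq_abs, abs_of_pos hε]
    exact mul_le_of_le_one_right hε.le (norm_fractVec_le _)
  refine Tendsto.congr' (f₁ := fun ε : ℝ =>
    ∫ x, ∫ y in unitCube d, G (x + ε • fractVec (y - ε⁻¹ • x)) y) ?_ ?_
  · filter_upwards [hsmall] with ε hε
    exact (integral_rescaled_eq_integral_shifted hG hm hM hR hε.1 hε.2).symm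
  refine tendsto_integral_filter_of_dominated_convergence
    ((Metric.closedBall (0 : Fin d → ℝ) (R + 1)).indicator fun _ => M) ?_ ?_ ?_ ?_
  · exact Eventually.of_forall fun ε =>
      (hmε ε).stronglyMeasurable.integral_prod_right'.aestronglyMeasurable
  · filter_upwards [hsmall] with ε hε
    refine ae_of_all _ fun x => ?_
    by_cases hx : x ∈ Metric.closedBall (0 : Fin d → ℝ) (R + 1)
    · rw [Set.indicator_of_mem hx]
      refine (norm_integral_le_of_norm_le_const (C := M) (ae_of_all _ fun y => hM _ _)).trans ?_
      simp
    · rw [Set.indicator_of_notMem hx]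
      have hz : ∀ y, G (x + ε • fractVec (y - ε⁻¹ • x)) y = 0 := fun y => by
        refine hR _ _ ?_
        have h1 := hdist hε.1 (y - ε⁻¹ • x)
        have h2 : R + 1 < ‖x‖ := by simpa using hx
        have h3 := norm_sub_le (x + ε • fractVec (y - ε⁻¹ • x)) (ε • fractVec (y - ε⁻¹ • x))
        rw [add_sub_cancel_right] at h3
        linarith [hε.2]
      simp [hz]
  · exact (integrable_indicator_iff measurableSet_closedBall).2
      (integrableOn_const measure_closedBall_lt_top.ne)
  · filter_upwards [hc] with x hx
    refine tendsto_integral_filter_of_dominated_convergence (fun _ => M) ?_ ?_ ?_ ?_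
    · exact Eventually.of_forall fun ε =>
        ((hmε ε).comp measurable_prodMk_left).aestronglyMeasurable
    · exact Eventually.of_forall fun ε => ae_of_all _ fun y => hM _ _
    · exact integrable_const M
    · filter_upwards [hx] with y hy
      have hlim : Tendsto (fun ε : ℝ => x + ε • fractVec (y - ε⁻¹ • x)) (𝓝[>] 0) (𝓝 x) := by
        have h0 : Tendsto (fun ε : ℝ => ε • fractVec (y - ε⁻¹ • x)) (𝓝[>] 0) (𝓝 0) := by
          refine squeeze_zero_norm' (a := fun ε => ε) ?_
            (tendsto_id.mono_left nhdsWithin_le_nhds)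
          filter_upwards [hsmall] with ε hε using hdist hε.1 _
        simpa using h0.const_add x
      exact hy.tendsto.comp hlim

lemma volume_preimage_smul_add {d : ℕ} {r : ℝ} (hr : 0 < r) (c : Fin d → ℝ)
    (B : Set (Fin d → ℝ)) :
    volume ((fun x => r • x + c) ⁻¹' B) = ENNReal.ofReal ((r ^ d)⁻¹) * volume B := by
  have h : (fun x => r • x + c) ⁻¹' B = (fun x => r • x) ⁻¹' ((fun x => x + c) ⁻¹' B) := rfl
  rw [h, Measure.addHaar_preimage_smul _ hr.ne', measure_preimage_add_right,
    Module.finrank_fin_fun, abs_of_pos (by positivity)]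

lemma card_piFinset_Ioc_floor_le {d : ℕ} (a : Fin d → ℝ) {r : ℝ} (hr : 0 ≤ r) :
    ((Fintype.piFinset fun k => Finset.Ioc ⌊a k⌋ ⌊a k + r⌋).card : ℝ) ≤ (r + 1) ^ d := by
  rw [Fintype.card_piFinset, Nat.cast_prod]
  refine (Finset.prod_le_prod (g := fun _ => r + 1) (fun k _ => Nat.cast_nonneg _)
    fun k _ => ?_).trans (by simp)
  have h1 : ⌊a k⌋ ≤ ⌊a k + r⌋ := Int.floor_le_floor (by linarith)
  have h2 : ((⌊a k + r⌋ - ⌊a k⌋).toNat : ℝ) = (⌊a k + r⌋ : ℝ) - ⌊a k⌋ := by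
    exact_mod_cast Int.toNat_of_nonneg (sub_nonneg.2 h1)
  rw [Int.card_Ioc, h2]
  linarith [Int.floor_le (a k + r), Int.lt_floor_add_one (a k)]

lemma map_cubePoint_rescaled_le {d : ℕ} {eb ε : ℝ} (hε : 0 < ε) (hle : ε ≤ eb) :
    (volume.map fun x : Fin d → ℝ => cubePoint eb x (ε⁻¹ • x))
      ≤ ENNReal.ofReal (2 ^ d) • volume := by
  have heb : 0 < eb := hε.trans_le hle
  set r : ℝ := eb / ε with hr
  have hr1 : 1 ≤ r := (one_le_div hε).2 hle
  have hr0 : 0 < r := by linarith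
  have hTm : Measurable fun x : Fin d → ℝ => cubePoint eb x (ε⁻¹ • x) :=
    (measurable_cubePoint eb).comp (measurable_id.prodMk (measurable_id.const_smul ε⁻¹))
  set q : ℝ := (1 - r⁻¹) / eb with hq
  set J : (Fin d → ℤ) → Set (Fin d → ℝ) :=
    fun I => {z | ∀ k, ⌊q * (z k + eb * I k) + 1/2⌋ = I k} with hJ
  have hJm : ∀ I, MeasurableSet (J I) := fun I => by
    have : J I = ⋂ k, {z | ⌊q * (z k + eb * I k) + 1/2⌋ = I k} := by
      ext z; simp [hJ]
    rw [this]
    refine MeasurableSet.iInter fun k => ?_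
    have hmk : Measurable fun z : Fin d → ℝ => q * (z k + eb * I k) + 1/2 := by fun_prop
    exact hmk.floor (measurableSet_singleton (I k))
  have hcount : ∀ z, ∑' I, (J I).indicator (fun _ => (1 : ENNReal)) z
      ≤ ENNReal.ofReal ((r + 1) ^ d) := fun z => by
    set F := Fintype.piFinset fun k =>
      Finset.Ioc ⌊r * (q * z k - 1/2)⌋ ⌊r * (q * z k - 1/2) + r⌋ with hF
    have hmem : ∀ I, z ∈ J I → I ∈ F := fun I hI => by
      rw [hF, Fintype.mem_piFinset]
      intro k
      have hk := Int.floor_eq_iff.1 (hI k)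
      have hexp : q * (z k + eb * I k) = q * z k + I k - I k / r := by
        rw [hq]; field_simp; ring
      rw [hexp] at hk
      rw [Finset.mem_Ioc, Int.floor_lt, Int.le_floor]
      have hIr : r * ((I k : ℝ) / r) = I k := by field_simp
      constructor
      · have := mul_lt_mul_of_pos_left (show q * z k - 1/2 < (I k : ℝ) / r by linarith) hr0
        linarith
      · have := mul_le_mul_of_nonneg_left
          (show (I k : ℝ) / r ≤ q * z k + 1/2 by linarith) hr0.le
        linarith
    rw [tsum_eq_sum (s := F) fun I hI => Set.indicator_of_notMem (fun h => hI (hmem I h)) _]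
    calc ∑ I ∈ F, (J I).indicator (fun _ => (1 : ENNReal)) z ≤ ∑ _I ∈ F, 1 :=
          Finset.sum_le_sum fun I _ => Set.indicator_le_self _ _ _
      _ = ENNReal.ofReal (F.card : ℝ) := by simp
      _ ≤ _ := ENNReal.ofReal_le_ofReal (card_piFinset_Ioc_floor_le _ hr0.le)
  refine Measure.le_iff.2 fun B hB => ?_
  rw [Measure.map_apply hTm hB, Measure.smul_apply, smul_eq_mul]
  have hcover : (fun x : Fin d → ℝ => cubePoint eb x (ε⁻¹ • x)) ⁻¹' B
      ⊆ ⋃ I : Fin d → ℤ, (fun x => r • x + fun k => -(eb * I k)) ⁻¹' (B ∩ J I) := by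
    intro x hx
    refine Set.mem_iUnion.2 ⟨fun k => ⌊(ε⁻¹ • x) k - x k / eb + 1/2⌋, ?_⟩
    set I : Fin d → ℤ := fun k => ⌊(ε⁻¹ • x) k - x k / eb + 1/2⌋ with hI
    have hpt : r • x + (fun k => -(eb * (I k : ℝ))) = cubePoint eb x (ε⁻¹ • x) := by
      ext k
      have hfr := Int.self_sub_floor ((ε⁻¹ • x) k - x k / eb + 1/2)
      change r * x k + -(eb * (I k : ℝ))
        = x k + eb * (Int.fract ((ε⁻¹ • x) k - x k / eb + 1/2) - 1/2)
      rw [← hfr, hr]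
      change _ = x k + eb * (ε⁻¹ * x k - x k / eb + 1/2 - (I k : ℝ) - 1/2)
      field_simp
      ring
    refine ⟨?_, fun k => ?_⟩
    · show r • x + (fun k => -(eb * (I k : ℝ))) ∈ B
      rw [hpt]; exact hx
    · show ⌊q * ((r • x + fun k => -(eb * (I k : ℝ))) k + eb * I k) + 1/2⌋ = I k
      rw [hI]
      congr 1
      simp only [hq, hr, Pi.add_apply, Pi.smul_apply, smul_eq_mul]
      field_simp
      ring
  calc volume ((fun x : Fin d → ℝ => cubePoint eb x (ε⁻¹ • x)) ⁻¹' B)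
      ≤ ∑' I : Fin d → ℤ, volume ((fun x => r • x + fun k => -(eb * I k)) ⁻¹' (B ∩ J I)) :=
        (measure_mono hcover).trans (measure_iUnion_le _)
    _ = ENNReal.ofReal ((r ^ d)⁻¹) * ∑' I : Fin d → ℤ, volume (B ∩ J I) := by
        simp only [volume_preimage_smul_add hr0, ENNReal.tsum_mul_left]
    _ = ENNReal.ofReal ((r ^ d)⁻¹)
          * ∫⁻ z in B, ∑' I : Fin d → ℤ, (J I).indicator (fun _ => (1 : ENNReal)) z := by
        rw [lintegral_tsum fun I => (measurable_const.indicator (hJm I)).aemeasurable]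
        congr 2
        ext I
        rw [lintegral_indicator_const (hJm I), one_mul, Measure.restrict_apply (hJm I),
          Set.inter_comm]
    _ ≤ ENNReal.ofReal ((r ^ d)⁻¹) * ∫⁻ _z in B, ENNReal.ofReal ((r + 1) ^ d) := by
        gcongr with z
        exact hcount z
    _ = ENNReal.ofReal ((r ^ d)⁻¹ * (r + 1) ^ d) * volume B := by
        rw [setLIntegral_const, ← mul_assoc, ENNReal.ofReal_mul (by positivity)]
    _ ≤ ENNReal.ofReal (2 ^ d) * volume B := by
        gcongr
        rw [inv_mul_le_iff₀ (by positivity), ← mul_pow]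
        gcongr
        linarith

lemma map_cubePoint_prod_le {d : ℕ} {eb : ℝ} (heb : 0 < eb) (Ω : Set (Fin d → ℝ)) :
    (((volume.restrict Ω).prod (volume.restrict (unitCube d))).map
        fun p : (Fin d → ℝ) × (Fin d → ℝ) => cubePoint eb p.1 p.2)
      ≤ (ENNReal.ofReal ((eb ^ d)⁻¹) * volume Ω) • volume := by
  refine Measure.le_iff.2 fun B hB => ?_
  rw [Measure.map_apply (measurable_cubePoint eb) hB,
    Measure.prod_apply (measurable_cubePoint eb hB), Measure.smul_apply, smul_eq_mul]
  have hx : ∀ x : Fin d → ℝ, volume.restrict (unitCube d)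
      (Prod.mk x ⁻¹' ((fun p : (Fin d → ℝ) × (Fin d → ℝ) => cubePoint eb p.1 p.2) ⁻¹' B))
      ≤ ENNReal.ofReal ((eb ^ d)⁻¹) * volume B := fun x => by
    have hmp := measurePreserving_fractVec_add (d := d) fun k => -(x k / eb) + 1/2
    set c : Fin d → ℝ := fun k => x k - eb * (1/2) with hc
    have hBm : MeasurableSet ((fun t : Fin d → ℝ => eb • t + c) ⁻¹' B) :=
      ((measurable_id.const_smul eb).add_const c) hB
    have hset : Prod.mk x ⁻¹' ((fun p : (Fin d → ℝ) × (Fin d → ℝ) => cubePoint eb p.1 p.2) ⁻¹' B)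
        = (fun y => fractVec (y + fun k => -(x k / eb) + 1/2)) ⁻¹'
          ((fun t => eb • t + c) ⁻¹' B) := by
      have hpt : ∀ y, cubePoint eb x y
          = eb • fractVec (y + fun k => -(x k / eb) + 1/2) + c := fun y => by
        ext k
        simp only [cubePoint, fractVec, hc, Pi.add_apply, Pi.smul_apply, smul_eq_mul]
        rw [← add_assoc (y k), ← sub_eq_add_neg (y k)]
        ring
      ext y
      simp only [Set.mem_preimage, hpt]
    rw [hset, hmp.measure_preimage hBm.nullMeasurableSet]
    exact (Measure.restrict_apply_le _ _).trans (volume_preimage_smul_add heb c B).le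
  refine (lintegral_mono hx).trans ?_
  rw [lintegral_const, Measure.restrict_apply_univ, mul_right_comm]

section Pushforward

variable {X E : Type*} [MeasurableSpace X] [MeasurableSpace E] {μ : Measure X} {ν : Measure E}
  {T : X → E} {C : ENNReal} {w : X → ℝ} {M : ℝ}

lemma integrable_comp_mul_of_map_le (hT : Measurable T) (hC : C ≠ ⊤) (hle : μ.map T ≤ C • ν)
    (hw : Measurable w) (hM : ∀ x, |w x| ≤ M) {A : E → ℝ} (hA : Integrable A ν) :
    Integrable (fun x => A (T x) * w x) μ :=
  ((hA.of_measure_le_smul hC hle).comp_measurable hT).mul_bdd hw.aestronglyMeasurable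
    (ae_of_all _ hM)

lemma abs_integral_comp_mul_sub_le (hT : Measurable T) (hC : C ≠ ⊤) (hle : μ.map T ≤ C • ν)
    (hw : Measurable w) (hM : ∀ x, |w x| ≤ M) (hM0 : 0 ≤ M) {A g : E → ℝ}
    (hA : Integrable A ν) (hg : Integrable g ν) :
    |∫ x, A (T x) * w x ∂μ - ∫ x, g (T x) * w x ∂μ| ≤ M * (C.toReal * ∫ z, ‖A z - g z‖ ∂ν) := by
  have hsub : Integrable (fun z => ‖A z - g z‖) ν := (hA.sub hg).norm
  have hmap : Integrable (fun z => ‖A z - g z‖) (μ.map T) := hsub.of_measure_le_smul hC hle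
  rw [← integral_sub (integrable_comp_mul_of_map_le hT hC hle hw hM hA)
    (integrable_comp_mul_of_map_le hT hC hle hw hM hg)]
  calc |∫ x, (A (T x) * w x - g (T x) * w x) ∂μ|
      ≤ ∫ x, M * ‖A (T x) - g (T x)‖ ∂μ := by
        rw [← Real.norm_eq_abs]
        refine norm_integral_le_of_norm_le ((hmap.comp_measurable hT).const_mul M)
          (ae_of_all _ fun x => ?_)
        rw [← sub_mul, norm_mul, mul_comm]
        exact mul_le_mul_of_nonneg_right (hM x) (norm_nonneg _)
    _ = M * ∫ z, ‖A z - g z‖ ∂(μ.map T) := by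
        rw [integral_const_mul, integral_map hT.aemeasurable hmap.aestronglyMeasurable]
    _ ≤ M * (C.toReal * ∫ z, ‖A z - g z‖ ∂ν) := by
        refine mul_le_mul_of_nonneg_left ?_ hM0
        rw [← smul_eq_mul, ← integral_smul_measure (fun z => ‖A z - g z‖)]
        exact integral_mono_measure hle (ae_of_all _ fun _ => norm_nonneg _)
          (hsub.smul_measure hC)

end Pushforward

/-- The function `f` with its slow variable cut off to `Ω`. -/
def slowCutoff {d : ℕ} (Ω : Set (Fin d → ℝ)) (f : (Fin d → ℝ) → (Fin d → ℝ) → ℝ)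
    (x y : Fin d → ℝ) : ℝ := Ω.indicator (fun x' => f x' y) x

lemma dist_cubePoint_le {d : ℕ} {eb : ℝ} (heb : 0 ≤ eb) (x y : Fin d → ℝ) :
    dist (cubePoint eb x y) x ≤ eb / 2 := by
  refine (dist_pi_le_iff (by positivity)).2 fun k => ?_
  have h0 := Int.fract_nonneg (y k - x k / eb + 1/2)
  have h1 := (Int.fract_lt_one (y k - x k / eb + 1/2)).le
  rw [Real.dist_eq, cubePoint, add_sub_cancel_left, abs_mul, abs_of_nonneg heb,
    show eb / 2 = eb * (1/2) by ring]
  refine mul_le_mul_of_nonneg_left (abs_le.2 ⟨?_, ?_⟩) heb <;> linarith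

lemma closure_unitCube (d : ℕ) :
    closure (unitCube d) = Set.univ.pi fun _ => Set.Icc (0:ℝ) 1 := by
  rw [unitCube, closure_pi_set]
  simp

lemma fractVec_mem_closure_unitCube {d : ℕ} (y : Fin d → ℝ) :
    fractVec y ∈ closure (unitCube d) := by
  rw [closure_unitCube]
  exact fun k _ => ⟨Int.fract_nonneg _, (Int.fract_lt_one _).le⟩

lemma isCompact_closure_unitCube (d : ℕ) : IsCompact (closure (unitCube d)) := by
  rw [closure_unitCube]
  exact isCompact_univ_pi fun _ => isCompact_Icc

section SlowCutoff

variable {d : ℕ} {Ω : Set (Fin d → ℝ)} {φ : (Fin d → ℝ) → (Fin d → ℝ) → ℝ}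

lemma exists_abs_slowCutoff_le (hΩb : Bornology.IsBounded Ω) (hper : YPeriodic φ)
    (hcont : ContinuousOn (uncurry φ) (closure Ω ×ˢ closure (unitCube d))) :
    ∃ M : ℝ, 0 ≤ M ∧ ∀ x y, |slowCutoff Ω φ x y| ≤ M := by
  obtain ⟨M, hM⟩ := (hΩb.isCompact_closure.prod
    (isCompact_closure_unitCube d)).exists_bound_of_continuousOn hcont
  refine ⟨max M 0, le_max_right _ _, fun x y => ?_⟩
  by_cases hx : x ∈ Ω
  · rw [slowCutoff, Set.indicator_of_mem hx, ← hper.apply_fractVec]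
    exact (hM (x, fractVec y) ⟨subset_closure hx, fractVec_mem_closure_unitCube y⟩).trans
      (le_max_left _ _)
  · rw [slowCutoff, Set.indicator_of_notMem hx, abs_zero]
    exact le_max_right _ _

lemma measurable_uncurry_slowCutoff (hΩm : MeasurableSet Ω) (hper : YPeriodic φ)
    (hcont : ContinuousOn (uncurry φ) (closure Ω ×ˢ closure (unitCube d))) :
    Measurable (uncurry (slowCutoff Ω φ)) := by
  classical
  have hm : Measurable ((Ω ×ˢ closure (unitCube d)).indicator (uncurry φ)) := by
    rw [← Set.piecewise_eq_indicator]
    exact (hcont.mono (Set.prod_mono_left subset_closure)).measurable_piecewise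
      continuousOn_const (hΩm.prod isClosed_closure.measurableSet)
  convert! hm.comp (measurable_fst.prodMk (measurable_fractVec.comp measurable_snd)) using 1
  ext ⟨x, y⟩
  have hy := fractVec_mem_closure_unitCube y
  by_cases hx : x ∈ Ω
  · simp [slowCutoff, hx, hy, hper.apply_fractVec]
  · simp [slowCutoff, hx]

lemma YPeriodic.slowCutoff (hper : YPeriodic φ) : YPeriodic (slowCutoff Ω φ) := fun x y m => by
  by_cases hx : x ∈ Ω <;> simp [_root_.slowCutoff, hx, hper x y m]

lemma continuousAt_slowCutoff (hΩo : IsOpen Ω)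
    (hcont : ContinuousOn (uncurry φ) (closure Ω ×ˢ closure (unitCube d)))
    {x y : Fin d → ℝ} (hx : x ∉ frontier Ω) (hy : y ∈ unitCube d) :
    ContinuousAt (fun x' => slowCutoff Ω φ x' y) x := by
  by_cases hxΩ : x ∈ Ω
  · have h1 : ContinuousOn (fun x' => φ x' y) Ω :=
      hcont.comp (Continuous.prodMk_left y).continuousOn
        fun x' hx' => ⟨subset_closure hx', subset_closure hy⟩
    refine (h1.continuousAt (hΩo.mem_nhds hxΩ)).congr ?_
    filter_upwards [hΩo.mem_nhds hxΩ] with x' hx'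
    rw [slowCutoff, Set.indicator_of_mem hx']
  · have hxc : x ∈ (closure Ω)ᶜ := fun h => hx ⟨h, by rwa [hΩo.interior_eq]⟩
    refine (continuousAt_const (y := (0:ℝ))).congr ?_
    filter_upwards [isClosed_closure.isOpen_compl.mem_nhds hxc] with x' hx'
    rw [slowCutoff, Set.indicator_of_notMem fun h => hx' (subset_closure h)]

end SlowCutoff

lemma YPeriodic.comp_cubePoint {d : ℕ} (g : (Fin d → ℝ) → ℝ) (eb : ℝ) :
    YPeriodic fun x y => g (cubePoint eb x y) := fun x y m => by
  refine congrArg g (funext fun k => ?_)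
  have h : (y + fun i => (m i : ℝ)) k - x k / eb + 1/2
      = (y k - x k / eb + 1/2) + (m k : ℝ) := by
    simp only [Pi.add_apply]
    ring
  rw [cubePoint, h, Int.fract_add_intCast]
  rfl

lemma continuousAt_cubePoint {d : ℕ} {eb : ℝ} {x y : Fin d → ℝ}
    (h : ∀ k, ∀ n : ℤ, y k ≠ n - 1/2 + x k / eb) :
    ContinuousAt (fun x' => cubePoint eb x' y) x := by
  refine continuousAt_pi.2 fun k => ?_
  have hk : ContinuousAt (fun x' : Fin d → ℝ => x' k) x := (continuous_apply k).continuousAt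
  have harg : ContinuousAt (fun x' : Fin d → ℝ => y k - x' k / eb + 1/2) x :=
    (continuousAt_const.sub (hk.div_const eb)).add continuousAt_const
  have hfract : ContinuousAt (fun x' : Fin d → ℝ => Int.fract (y k - x' k / eb + 1/2)) x := by
    refine ContinuousAt.comp (f := fun x' : Fin d → ℝ => y k - x' k / eb + 1/2)
      (continuousAt_fract fun he => h k ⌊y k - x k / eb + 1/2⌋ ?_) harg
    linarith
  exact hk.add (continuousAt_const.mul (hfract.sub continuousAt_const))

lemma ae_forall_ne_intCast_add {d : ℕ} (c : Fin d → ℝ) :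
    ∀ᵐ y : Fin d → ℝ, ∀ k, ∀ n : ℤ, y k ≠ n - 1/2 + c k := by
  refine ae_all_iff.2 fun k => ae_all_iff.2 fun n => ?_
  rw [volume_pi]
  exact Measure.ae_eval_ne _ k _

lemma tendsto_integral_rescaled_cubePoint {d : ℕ} {Ω : Set (Fin d → ℝ)} (hΩo : IsOpen Ω)
    (hΩb : Bornology.IsBounded Ω) (hfr : volume (frontier Ω) = 0) (eb : ℝ)
    {φ : (Fin d → ℝ) → (Fin d → ℝ) → ℝ} (hper : YPeriodic φ)
    (hcont : ContinuousOn (uncurry φ) (closure Ω ×ˢ closure (unitCube d)))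
    {g : (Fin d → ℝ) → ℝ} (hg : Continuous g) (hgc : HasCompactSupport g) :
    Tendsto (fun ε : ℝ => ∫ x in Ω, g (cubePoint eb x (ε⁻¹ • x)) * slowCutoff Ω φ x (ε⁻¹ • x))
      (𝓝[>] (0:ℝ))
      (𝓝 (∫ x in Ω, ∫ y in unitCube d, g (cubePoint eb x y) * slowCutoff Ω φ x y)) := by
  obtain ⟨M, hM0, hM⟩ := exists_abs_slowCutoff_le hΩb hper hcont
  obtain ⟨N, hN⟩ := hg.bounded_above_of_compact_support hgc
  obtain ⟨R, hR⟩ := hΩb.exists_norm_le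
  have hzero : ∀ x y, x ∉ Ω → slowCutoff Ω φ x y = 0 := fun x y hx =>
    Set.indicator_of_notMem hx _
  have hlim := tendsto_integral_rescaled
    (G := fun x y => g (cubePoint eb x y) * slowCutoff Ω φ x y) (M := N * M) (R := R)
    (fun x y m => congrArg₂ (· * ·) (YPeriodic.comp_cubePoint g eb x y m)
      (hper.slowCutoff x y m))
    ((hg.measurable.comp (measurable_cubePoint eb)).mul
      (measurable_uncurry_slowCutoff hΩo.measurableSet hper hcont))
    (fun x y => by
      rw [abs_mul]
      exact mul_le_mul (hN _) (hM x y) (abs_nonneg _) ((norm_nonneg _).trans (hN 0)))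
    (fun x y hx => by
      rw [hzero x y fun h => hx.not_ge (hR x h), mul_zero])
    (by
      filter_upwards [measure_eq_zero_iff_ae_notMem.1 hfr] with x hx
      filter_upwards [ae_restrict_of_ae (ae_forall_ne_intCast_add fun k => x k / eb),
        ae_restrict_mem (MeasurableSet.univ_pi fun _ => measurableSet_Ioo)] with y hy hyY
      exact (hg.continuousAt.comp (continuousAt_cubePoint hy)).mul
        (continuousAt_slowCutoff hΩo hcont hx hyY))
  refine (hlim.congr fun ε => ?_).trans_eq ?_
  · exact (setIntegral_eq_integral_of_forall_compl_eq_zero fun x hx => by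
      rw [hzero x _ hx, mul_zero]).symm
  · rw [setIntegral_eq_integral_of_forall_compl_eq_zero fun x hx => by
      simp [hzero x _ hx]]

/-- For `a_M ∈ L¹(Ω̃)`, `φ` continuous on the closure of `Ω × Y` and `Y`-periodic in `y`,
and `a` the two-scale Continuous Extension of `a_M`:
`∫_Ω a(x,x/ε)φ(x,x/ε) dx → ∫_Ω ∫_Y a(x,y)φ(x,y) dy dx` as `ε → 0⁺` (the boundary of `Ω`
being regular enough: it is a Lebesgue null set). -/
theorem statement13 {d : ℕ} (Ωt Ω : Set (Fin d → ℝ))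
    (hΩo : IsOpen Ω) (hΩb : Bornology.IsBounded Ω) (hΩt : Bornology.IsBounded Ωt)
    (hfr : volume (frontier Ω) = 0)
    (aM : (Fin d → ℝ) → ℝ) (haM : IntegrableOn aM Ωt)
    (eb : ℝ) (heb : 0 < eb)
    (hW : ∀ x ∈ closure Ω, cube x eb ⊆ Ωt)
    (φ : (Fin d → ℝ) → (Fin d → ℝ) → ℝ) (hper : YPeriodic φ)
    (hcont : ContinuousOn (uncurry φ) (closure Ω ×ˢ closure (unitCube d))) :
    Tendsto (fun ε : ℝ => ∫ x in Ω, contExt aM eb x (ε⁻¹ • x) * φ x (ε⁻¹ • x))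
      (𝓝[>] (0:ℝ))
      (𝓝 (∫ x in Ω, ∫ y in unitCube d, contExt aM eb x y * φ x y)) := by
  have hK : IsCompact (Metric.cthickening (eb / 2) (closure Ω)) :=
    hΩb.isCompact_closure.cthickening
  have hKt : Metric.cthickening (eb / 2) (closure Ω) ⊆ Ωt := by
    rw [hΩb.isCompact_closure.cthickening_eq_biUnion_closedBall (by positivity)]
    refine Set.iUnion₂_subset fun x hx z hz => hW x hx fun k => ?_
    exact (norm_le_pi_norm (z - x) k).trans (mem_closedBall_iff_norm.1 hz)
  set A : (Fin d → ℝ) → ℝ := (Metric.cthickening (eb / 2) (closure Ω)).indicator aM with hA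
  have hAint : Integrable A :=
    (integrable_indicator_iff hK.measurableSet).2 (haM.mono_set hKt)
  have hΩm : MeasurableSet Ω := hΩo.measurableSet
  have hAeq : ∀ x ∈ Ω, ∀ y, contExt aM eb x y = A (cubePoint eb x y) := fun x hx y =>
    (Set.indicator_of_mem (Metric.mem_cthickening_of_dist_le _ x _ _ (subset_closure hx)
      (dist_cubePoint_le heb.le x y)) aM).symm
  obtain ⟨M, hM0, hM⟩ := exists_abs_slowCutoff_le hΩb hper hcont
  have hwm := measurable_uncurry_slowCutoff hΩm hper hcont
  have hL : ∀ ε : ℝ, ∫ x in Ω, contExt aM eb x (ε⁻¹ • x) * φ x (ε⁻¹ • x)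
      = ∫ x in Ω, A (cubePoint eb x (ε⁻¹ • x)) * slowCutoff Ω φ x (ε⁻¹ • x) := fun ε =>
    setIntegral_congr_fun hΩm fun x hx => by
      simp only [hAeq x hx, slowCutoff, Set.indicator_of_mem hx]
  have hL₀ : ∫ x in Ω, ∫ y in unitCube d, contExt aM eb x y * φ x y
      = ∫ x in Ω, ∫ y in unitCube d, A (cubePoint eb x y) * slowCutoff Ω φ x y :=
    setIntegral_congr_fun hΩm fun x hx => by
      simp only [hAeq x hx, slowCutoff, Set.indicator_of_mem hx]
  simp only [hL, hL₀]
  have hC₀ : ENNReal.ofReal ((eb ^ d)⁻¹) * volume Ω ≠ ⊤ :=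
    ENNReal.mul_ne_top ENNReal.ofReal_ne_top hΩb.measure_lt_top.ne
  have hprod : ∀ {f : (Fin d → ℝ) → ℝ}, Integrable f →
      ∫ x in Ω, ∫ y in unitCube d, f (cubePoint eb x y) * slowCutoff Ω φ x y
        = ∫ p, f (cubePoint eb p.1 p.2) * uncurry (slowCutoff Ω φ) p
            ∂(volume.restrict Ω).prod (volume.restrict (unitCube d)) := fun {f} hf =>
    (integral_prod (fun p : (Fin d → ℝ) × (Fin d → ℝ) =>
        f (cubePoint eb p.1 p.2) * uncurry (slowCutoff Ω φ) p)
      (integrable_comp_mul_of_map_le (measurable_cubePoint eb) hC₀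
        (map_cubePoint_prod_le heb Ω) hwm (fun p => hM p.1 p.2) hf)).symm
  set C : ℝ := M * (2 ^ d + (ENNReal.ofReal ((eb ^ d)⁻¹) * volume Ω).toReal) + 1 with hC
  have hCpos : 0 < C := by positivity
  refine Metric.tendsto_nhds.2 fun η hη => ?_
  obtain ⟨g, hgc, hgA, hg, hgi⟩ :=
    hAint.exists_hasCompactSupport_integral_sub_le (div_pos (half_pos hη) hCpos)
  have hlim := tendsto_integral_rescaled_cubePoint hΩo hΩb hfr eb hper hcont hg hgc
  filter_upwards [Metric.tendsto_nhds.1 hlim (η / 2) (half_pos hη), Ioc_mem_nhdsGT heb]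
    with ε hε hεI
  have hTm : Measurable fun x : Fin d → ℝ => cubePoint eb x (ε⁻¹ • x) :=
    (measurable_cubePoint eb).comp (measurable_id.prodMk (measurable_id.const_smul ε⁻¹))
  have h1 := abs_integral_comp_mul_sub_le (μ := volume.restrict Ω) hTm ENNReal.ofReal_ne_top
    ((Measure.map_mono Measure.restrict_le_self hTm).trans
      (map_cubePoint_rescaled_le hεI.1 hεI.2))
    (w := fun x => slowCutoff Ω φ x (ε⁻¹ • x))
    (hwm.comp (measurable_id.prodMk (measurable_id.const_smul ε⁻¹))) (fun x => hM _ _) hM0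
    hAint hgi
  have h2 := abs_integral_comp_mul_sub_le (measurable_cubePoint eb) hC₀
    (map_cubePoint_prod_le heb Ω) hwm (fun p => hM p.1 p.2) hM0 hAint hgi
  rw [← hprod hAint, ← hprod hgi] at h2
  rw [ENNReal.toReal_ofReal (by positivity)] at h1
  rw [Real.dist_eq] at hε ⊢
  have hsum : M * (2 ^ d * ∫ z, ‖A z - g z‖)
      + M * ((ENNReal.ofReal ((eb ^ d)⁻¹) * volume Ω).toReal * ∫ z, ‖A z - g z‖) ≤ η / 2 := by
    have h3 : C * ∫ z, ‖A z - g z‖ ≤ η / 2 := by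
      rwa [le_div_iff₀' hCpos] at hgA
    have h4 : 0 ≤ ∫ z, ‖A z - g z‖ := integral_nonneg fun z => norm_nonneg _
    rw [hC] at h3
    linarith
  rw [abs_lt] at hε ⊢
  rw [abs_le] at h1 h2
  constructor <;> linarith [h1.1, h1.2, h2.1, h2.2, hε.1, hε.2]

end
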